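/- Let f : ℝⁿ → ℝ be a nonconstant polynomial, n ≥ 2. The following are equivalent: (a) f_Δ > 0 on (ℝ\{0})ⁿ for all Δ ∈ Γ_∞(f); (b) there exist c₁, c₂, R > 0 with c₁𝒫(x) ≤ f(x) ≤ c₂𝒫(x) for all ‖x‖ > R, where 𝒫(x) = Σ_{α ∈ Γ(f) ∩ ℤ₊ⁿ}|x^α|; (c) f is non-degenerate at infinity and f(x) ≥ 0 for all ‖x‖ > R for some R > 0. -/

import Mathlib

open MvPolynomial Set Asymptotics Filter

/-- The exponent vector of a monomial, viewed in `ℝⁿ`. -/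
noncomputable def expR {n : ℕ} (α : Fin n →₀ ℕ) : Fin n → ℝ := fun i => (α i : ℝ)

/-- The Newton polyhedron (at infinity) of a polynomial: the convex hull of its exponents. -/
noncomputable def Newton {n : ℕ} (f : MvPolynomial (Fin n) ℝ) : Set (Fin n → ℝ) :=
  convexHull ℝ (expR '' (f.support : Set (Fin n →₀ ℕ)))

/-- `d(q, Γ(f))`: the minimal value of `⟨q, ·⟩` on the Newton polyhedron. -/
noncomputable def dMin {n : ℕ} (q : Fin n → ℝ) (f : MvPolynomial (Fin n) ℝ) : ℝ :=
  sInf ((fun α : Fin n → ℝ => ∑ i, q i * α i) '' Newton f)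

/-- `Δ(q, Γ(f))`: the face of the Newton polyhedron where `⟨q, ·⟩` attains its minimum. -/
noncomputable def face {n : ℕ} (q : Fin n → ℝ) (f : MvPolynomial (Fin n) ℝ) : Set (Fin n → ℝ) :=
  {α ∈ Newton f | ∑ i, q i * α i = dMin q f}

/-- The Newton boundary at infinity: faces `Δ(q, Γ(f))` with `min_j q_j < 0`. -/
noncomputable def NewtonBoundary {n : ℕ} (f : MvPolynomial (Fin n) ℝ) : Set (Set (Fin n → ℝ)) :=
  {Δ | ∃ q : Fin n → ℝ, (∃ j, q j < 0) ∧ Δ = face q f}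

open Classical in
/-- The truncation `f_Δ` of `f` to a face `Δ`. -/
noncomputable def trunc {n : ℕ} (f : MvPolynomial (Fin n) ℝ) (Δ : Set (Fin n → ℝ)) :
    MvPolynomial (Fin n) ℝ :=
  ∑ α ∈ f.support.filter (fun α => expR α ∈ Δ), monomial α (f.coeff α)

/-- `𝒫(x) = Σ_{α ∈ Γ(f) ∩ ℤ₊ⁿ} |x^α|`. -/
noncomputable def P {n : ℕ} (f : MvPolynomial (Fin n) ℝ) (x : Fin n → ℝ) : ℝ :=
  ∑' α : {α : Fin n →₀ ℕ // expR α ∈ Newton f}, |∏ i, x i ^ ((α : Fin n →₀ ℕ) i)|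

/-- Non-degeneracy at infinity. -/
def Nondeg {n : ℕ} (f : MvPolynomial (Fin n) ℝ) : Prop :=
  ∀ Δ ∈ NewtonBoundary f, ¬ ∃ x : Fin n → ℝ, (∀ i, x i ≠ 0) ∧
    eval x (trunc f Δ) = 0 ∧ ∀ i, eval x (pderiv i (trunc f Δ)) = 0

/-- The norm of a polynomial: the maximum of the absolute values of its coefficients. -/
noncomputable def polyNorm {n : ℕ} (f : MvPolynomial (Fin n) ℝ) : ℝ :=
  ⨆ α ∈ f.support, |f.coeff α|

/-- Stable compactness of the zero set of `f`. -/
def StablyCompact {n : ℕ} (f : MvPolynomial (Fin n) ℝ) : Prop :=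
  ∃ ε > 0, ∀ g : MvPolynomial (Fin n) ℝ, Newton g ⊆ Newton f → polyNorm g < ε →
    IsCompact {x : Fin n → ℝ | eval x (f + g) = 0}

/-- The sum of the absolute values of the monomials that occur in `f`. -/
noncomputable def supportSum {n : ℕ} (f : MvPolynomial (Fin n) ℝ) (x : Fin n → ℝ) : ℝ :=
  ∑ α ∈ f.support, |∏ i, x i ^ α i|

theorem expR_mem_Newton {n : ℕ} {f : MvPolynomial (Fin n) ℝ} {α : Fin n →₀ ℕ}
    (hα : α ∈ f.support) : expR α ∈ Newton f :=
  subset_convexHull ℝ _ (mem_image_of_mem _ hα)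

theorem finite_lattice_Newton {n : ℕ} (f : MvPolynomial (Fin n) ℝ) :
    {α : Fin n →₀ ℕ | expR α ∈ Newton f}.Finite := by
  have hsub : Newton f ⊆ Set.Iic (fun _ => (f.totalDegree : ℝ)) := by
    refine convexHull_min ?_ (convex_Iic _)
    rintro _ ⟨α, hα, rfl⟩ i
    have := (monomial_le_degreeOf i (Finset.mem_coe.1 hα)).trans (degreeOf_le_totalDegree f i)
    simpa [expR] using this
  refine (Set.finite_Iic (Finsupp.equivFunOnFinite.symm (fun _ : Fin n => f.totalDegree))).subset ?_
  intro α hα i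
  have := hsub hα i
  simpa [expR] using this

theorem convex_setOf_prod_rpow_le {ι : Type*} [Fintype ι] {y : ι → ℝ} (hy : ∀ i, 0 ≤ y i) (Q : ℝ) :
    Convex ℝ {v : ι → ℝ | 0 ≤ v ∧ ∏ i, y i ^ v i ≤ Q} := by
  rintro v ⟨hv, hvQ⟩ w ⟨hw, hwQ⟩ a b ha hb hab
  refine ⟨add_nonneg (smul_nonneg ha hv) (smul_nonneg hb hw), ?_⟩
  have hnn : ∀ u : ι → ℝ, 0 ≤ ∏ i, y i ^ u i := fun u =>
    Finset.prod_nonneg fun i _ => Real.rpow_nonneg (hy i) _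
  have hpow : ∀ (u : ι → ℝ) (c : ℝ), ∏ i, y i ^ (c * u i) = (∏ i, y i ^ u i) ^ c := by
    intro u c
    rw [← Real.finsetProd_rpow _ _ fun i _ => Real.rpow_nonneg (hy i) _]
    exact Finset.prod_congr rfl fun i _ => by rw [mul_comm, Real.rpow_mul (hy i)]
  calc ∏ i, y i ^ (a • v + b • w) i
      = (∏ i, y i ^ (a * v i)) * ∏ i, y i ^ (b * w i) := by
        rw [← Finset.prod_mul_distrib]
        refine Finset.prod_congr rfl fun i _ => ?_
        simp only [Pi.add_apply, Pi.smul_apply, smul_eq_mul]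
        exact Real.rpow_add_of_nonneg (hy i) (mul_nonneg ha (hv i)) (mul_nonneg hb (hw i))
    _ = (∏ i, y i ^ v i) ^ a * (∏ i, y i ^ w i) ^ b := by rw [hpow, hpow]
    _ ≤ a * (∏ i, y i ^ v i) + b * ∏ i, y i ^ w i :=
        Real.geom_mean_le_arith_mean2_weighted ha hb (hnn v) (hnn w) hab
    _ ≤ a * Q + b * Q := by gcongr
    _ = Q := by rw [← add_mul, hab, one_mul]

theorem abs_monomial_eq_rpow {n : ℕ} (x : Fin n → ℝ) (α : Fin n →₀ ℕ) :
    |∏ i, x i ^ α i| = ∏ i, |x i| ^ expR α i := by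
  simp [expR, Finset.abs_prod, abs_pow]

theorem abs_monomial_le_supportSum {n : ℕ} {f : MvPolynomial (Fin n) ℝ} {α : Fin n →₀ ℕ}
    (hα : expR α ∈ Newton f) (x : Fin n → ℝ) : |∏ i, x i ^ α i| ≤ supportSum f x := by
  rw [abs_monomial_eq_rpow]
  refine (convexHull_min ?_ (convex_setOf_prod_rpow_le (fun i => abs_nonneg (x i))
    (supportSum f x)) hα).2
  rintro _ ⟨β, hβ, rfl⟩
  refine ⟨fun i => Nat.cast_nonneg _, ?_⟩
  rw [← abs_monomial_eq_rpow]
  exact Finset.single_le_sum (f := fun β : Fin n →₀ ℕ => |∏ i, x i ^ β i|)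
    (fun _ _ => abs_nonneg _) hβ

theorem P_eq_sum {n : ℕ} (f : MvPolynomial (Fin n) ℝ) (x : Fin n → ℝ) :
    P f x = ∑ α ∈ (finite_lattice_Newton f).toFinset, |∏ i, x i ^ α i| := by
  have : Fintype {α : Fin n →₀ ℕ // expR α ∈ Newton f} := (finite_lattice_Newton f).fintype
  rw [P, tsum_fintype]
  exact (Finset.sum_subtype _ (by simp) (fun α : Fin n →₀ ℕ => |∏ i, x i ^ α i|)).symm

theorem supportSum_le_P {n : ℕ} (f : MvPolynomial (Fin n) ℝ) (x : Fin n → ℝ) :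
    supportSum f x ≤ P f x := by
  rw [P_eq_sum]
  refine Finset.sum_le_sum_of_subset_of_nonneg ?_ fun _ _ _ => abs_nonneg _
  intro α hα
  simpa using expR_mem_Newton hα

theorem P_nonneg {n : ℕ} (f : MvPolynomial (Fin n) ℝ) (x : Fin n → ℝ) : 0 ≤ P f x :=
  tsum_nonneg fun _ => abs_nonneg _

theorem P_le_supportSum {n : ℕ} (f : MvPolynomial (Fin n) ℝ) :
    ∃ N > (0 : ℝ), ∀ x, P f x ≤ N * supportSum f x := by
  refine ⟨(finite_lattice_Newton f).toFinset.card + 1, by positivity, fun x => ?_⟩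
  have h0 : 0 ≤ supportSum f x := Finset.sum_nonneg fun _ _ => abs_nonneg _
  rw [P_eq_sum]
  calc _ ≤ (finite_lattice_Newton f).toFinset.card • supportSum f x :=
        Finset.sum_le_card_nsmul _ _ _ fun α hα =>
          abs_monomial_le_supportSum (by simpa using hα) x
    _ ≤ _ := by rw [nsmul_eq_mul]; nlinarith

theorem eval_le_P {n : ℕ} (f : MvPolynomial (Fin n) ℝ) :
    ∃ c > (0 : ℝ), ∀ x, eval x f ≤ c * P f x := by
  refine ⟨∑ α ∈ f.support, |f.coeff α| + 1, by positivity, fun x => ?_⟩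
  have hle : ∀ α ∈ f.support, f.coeff α * ∏ i, x i ^ α i ≤ |f.coeff α| * P f x := by
    intro α hα
    refine (le_abs_self _).trans ?_
    rw [abs_mul]
    gcongr
    exact (abs_monomial_le_supportSum (expR_mem_Newton hα) x).trans (supportSum_le_P f x)
  rw [eval_eq']
  refine (Finset.sum_le_sum hle).trans ?_
  rw [← Finset.sum_mul]
  nlinarith [P_nonneg f x]

theorem exists_isMin_support {n : ℕ} {f : MvPolynomial (Fin n) ℝ} (hf : f ≠ 0) (q : Fin n → ℝ) :
    ∃ β ∈ f.support, dMin q f = ∑ i, q i * expR β i ∧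
      ∀ γ ∈ f.support, ∑ i, q i * expR β i ≤ ∑ i, q i * expR γ i := by
  obtain ⟨β, hβ, hmin⟩ := Finset.exists_min_image f.support (fun γ => ∑ i, q i * expR γ i)
    (support_nonempty.2 hf)
  refine ⟨β, hβ, IsLeast.csInf_eq ⟨mem_image_of_mem _ (expR_mem_Newton hβ), ?_⟩, hmin⟩
  rintro _ ⟨v, hv, rfl⟩
  have hconv : Convex ℝ {v : Fin n → ℝ | ∑ i, q i * expR β i ≤ ∑ i, q i * v i} := by
    refine convex_halfSpace_ge (f := fun v : Fin n → ℝ => ∑ i, q i * v i) ⟨?_, ?_⟩ _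
    · intro v w
      simp [mul_add, Finset.sum_add_distrib]
    · intro c v
      simp only [Pi.smul_apply, smul_eq_mul, Finset.mul_sum]
      exact Finset.sum_congr rfl fun i _ => by ring
  refine convexHull_min ?_ hconv hv
  rintro _ ⟨γ, hγ, rfl⟩
  exact hmin γ hγ

theorem expR_mem_face_iff {n : ℕ} {f : MvPolynomial (Fin n) ℝ} {q : Fin n → ℝ} {β : Fin n →₀ ℕ}
    (hβ : β ∈ f.support) : expR β ∈ face q f ↔
      ∀ γ ∈ f.support, ∑ i, q i * expR β i ≤ ∑ i, q i * expR γ i := by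
  obtain ⟨β₀, hβ₀, hd, hmin⟩ := exists_isMin_support (support_nonempty.1 ⟨β, hβ⟩) q
  constructor
  · rintro ⟨-, h⟩ γ hγ
    rw [h, hd]
    exact hmin γ hγ
  · intro h
    exact ⟨expR_mem_Newton hβ, by rw [hd]; exact le_antisymm (h β₀ hβ₀) (hmin β hβ)⟩

open Classical in
theorem eval_trunc {n : ℕ} (f : MvPolynomial (Fin n) ℝ) (Δ : Set (Fin n → ℝ)) (x : Fin n → ℝ) :
    eval x (trunc f Δ) =
      ∑ α ∈ f.support, f.coeff α * if expR α ∈ Δ then ∏ i, x i ^ α i else 0 := by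
  rw [trunc, map_sum, Finset.sum_filter]
  refine Finset.sum_congr rfl fun α _ => ?_
  split_ifs
  · rw [eval_monomial, Finsupp.prod_fintype _ _ fun _ => pow_zero _]
  · rw [mul_zero]

theorem tendsto_eval_div {n : ℕ} {ι : Type*} {l : Filter ι} (f : MvPolynomial (Fin n) ℝ)
    (Δ : Set (Fin n → ℝ)) {x : ι → Fin n → ℝ} {D : ι → ℝ} {x₀ : Fin n → ℝ} {r : ℝ}
    (hmem : ∀ α ∈ f.support, expR α ∈ Δ →
      Tendsto (fun k => (∏ i, x k i ^ α i) / D k) l (nhds ((∏ i, x₀ i ^ α i) * r)))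
    (hnot : ∀ α ∈ f.support, expR α ∉ Δ →
      Tendsto (fun k => (∏ i, x k i ^ α i) / D k) l (nhds 0)) :
    Tendsto (fun k => eval (x k) f / D k) l (nhds (eval x₀ (trunc f Δ) * r)) := by
  classical
  rw [eval_trunc]
  simp only [eval_eq', Finset.sum_div, Finset.sum_mul, mul_div_assoc, mul_assoc]
  refine tendsto_finsetSum _ fun α hα => Tendsto.const_mul (f.coeff α) ?_
  by_cases h : expR α ∈ Δ
  · simpa [h] using hmem α hα h
  · simpa [h] using hnot α hα h

theorem prod_mul_exp_pow {n : ℕ} (s y : Fin n → ℝ) (α : Fin n →₀ ℕ) :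
    ∏ i, (s i * Real.exp (y i)) ^ α i = (∏ i, s i ^ α i) * Real.exp (∑ i, y i * expR α i) := by
  rw [Real.exp_sum, ← Finset.prod_mul_distrib]
  refine Finset.prod_congr rfl fun i _ => ?_
  rw [mul_pow, ← Real.exp_nat_mul, expR, mul_comm (y i)]

theorem tendsto_eval_curve_div {n : ℕ} {f : MvPolynomial (Fin n) ℝ} {q : Fin n → ℝ}
    {β : Fin n →₀ ℕ} (hβ : β ∈ f.support) (hβq : expR β ∈ face q f) (x₀ : Fin n → ℝ) :
    Tendsto (fun t : ℝ => eval (fun i => x₀ i * Real.exp (-t * q i)) f /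
      Real.exp (-t * ∑ i, q i * expR β i)) atTop (nhds (eval x₀ (trunc f (face q f)))) := by
  have hmin := (expR_mem_face_iff hβ).1 hβq
  have hterm : ∀ (α : Fin n →₀ ℕ) (t : ℝ), (∏ i, (x₀ i * Real.exp (-t * q i)) ^ α i) /
      Real.exp (-t * ∑ i, q i * expR β i) = (∏ i, x₀ i ^ α i) *
        Real.exp (-(t * (∑ i, q i * expR α i - ∑ i, q i * expR β i))) := by
    intro α t
    rw [prod_mul_exp_pow, mul_div_assoc, ← Real.exp_sub]
    congr 2
    simp only [mul_assoc, ← Finset.mul_sum]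
    ring
  rw [← mul_one (eval x₀ (trunc f (face q f)))]
  refine tendsto_eval_div f _ (fun α hα h => ?_) (fun α hα h => ?_)
  · simp only [hterm]
    have h0 : ∑ i, q i * expR α i - ∑ i, q i * expR β i = 0 :=
      sub_eq_zero.2 (le_antisymm ((expR_mem_face_iff hα).1 h β hβ) (hmin α hα))
    simp [h0]
  · simp only [hterm]
    have h0 : 0 < ∑ i, q i * expR α i - ∑ i, q i * expR β i := by
      refine sub_pos.2 (lt_of_not_ge fun hle => h ?_)
      exact (expR_mem_face_iff hα).2 fun γ hγ => hle.trans (hmin γ hγ)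
    rw [← mul_zero (∏ i, x₀ i ^ α i)]
    exact (Real.tendsto_exp_neg_atTop_nhds_zero.comp
      (tendsto_id.atTop_mul_const h0)).const_mul _

theorem tendsto_norm_curve_atTop {n : ℕ} {q x₀ : Fin n → ℝ} {j : Fin n} (hj : q j < 0)
    (hx₀ : x₀ j ≠ 0) :
    Tendsto (fun t : ℝ => ‖fun i => x₀ i * Real.exp (-t * q i)‖) atTop atTop := by
  refine tendsto_atTop_mono (f := fun t : ℝ => |x₀ j| * Real.exp (t * -q j)) (fun t => ?_) ?_
  · refine le_of_eq_of_le ?_ (norm_le_pi_norm (fun i => x₀ i * Real.exp (-t * q i)) j)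
    simp
  · exact (Real.tendsto_exp_atTop.comp
      (tendsto_id.atTop_mul_const (neg_pos.2 hj))).const_mul_atTop (abs_pos.2 hx₀)

theorem hasDerivAt_eval_update {n : ℕ} (g : MvPolynomial (Fin n) ℝ) (x : Fin n → ℝ) (i : Fin n)
    (t : ℝ) : HasDerivAt (fun t => eval (Function.update x i t) g)
      (eval (Function.update x i t) (pderiv i g)) t := by
  induction g using MvPolynomial.induction_on with
  | C a => simpa using hasDerivAt_const t a
  | add p q hp hq => simpa using hp.fun_add hq
  | mul_X p j hp =>
    have hX : HasDerivAt (fun t => eval (Function.update x i t) (X j : MvPolynomial (Fin n) ℝ))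
        (eval (Function.update x i t) (pderiv i (X j))) t := by
      rcases eq_or_ne j i with rfl | h
      · simpa using hasDerivAt_id' t
      · simpa [h, pderiv_X_of_ne h] using hasDerivAt_const t (x j)
    simp only [pderiv_mul, map_add, map_mul]
    exact hp.fun_mul hX

theorem eval_pderiv_eq_zero_of_isLocalMin {n : ℕ} {g : MvPolynomial (Fin n) ℝ} {x : Fin n → ℝ}
    (h : IsLocalMin (fun y => eval y g) x) (i : Fin n) : eval x (pderiv i g) = 0 := by
  have hd := hasDerivAt_eval_update g x i (x i)
  rw [Function.update_eq_self] at hd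
  refine IsLocalMin.hasDerivAt_eq_zero ?_ hd
  have hc : Tendsto (fun t => Function.update x i t) (nhds (x i)) (nhds x) := by
    have : Continuous fun t : ℝ => Function.update x i t := by fun_prop
    simpa using this.tendsto (x i)
  have := hc.eventually h
  simpa [IsLocalMin, IsMinFilter] using this

theorem eval_trunc_nonneg {n : ℕ} {f : MvPolynomial (Fin n) ℝ} (hf : f ≠ 0) {R : ℝ}
    (h : ∀ x : Fin n → ℝ, R < ‖x‖ → 0 ≤ eval x f) {Δ : Set (Fin n → ℝ)}
    (hΔ : Δ ∈ NewtonBoundary f) {x : Fin n → ℝ} (hx : ∀ i, x i ≠ 0) :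
    0 ≤ eval x (trunc f Δ) := by
  obtain ⟨q, ⟨j, hj⟩, rfl⟩ := hΔ
  obtain ⟨β, hβ, -, hmin⟩ := exists_isMin_support hf q
  refine ge_of_tendsto (tendsto_eval_curve_div hβ ((expR_mem_face_iff hβ).2 hmin) x) ?_
  filter_upwards [(tendsto_norm_curve_atTop hj (hx j)).eventually_gt_atTop R] with t ht
  exact div_nonneg (h _ ht) (Real.exp_pos _).le

theorem eval_trunc_pos_of_P_le {n : ℕ} {f : MvPolynomial (Fin n) ℝ} (hf : f ≠ 0) {c R : ℝ}
    (hc : 0 < c) (h : ∀ x : Fin n → ℝ, R < ‖x‖ → c * P f x ≤ eval x f) {Δ : Set (Fin n → ℝ)}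
    (hΔ : Δ ∈ NewtonBoundary f) {x : Fin n → ℝ} (hx : ∀ i, x i ≠ 0) :
    0 < eval x (trunc f Δ) := by
  obtain ⟨q, ⟨j, hj⟩, rfl⟩ := hΔ
  obtain ⟨β, hβ, -, hmin⟩ := exists_isMin_support hf q
  have hpos : 0 < c * |∏ i, x i ^ β i| :=
    mul_pos hc (abs_pos.2 (Finset.prod_ne_zero_iff.2 fun i _ => pow_ne_zero _ (hx i)))
  refine hpos.trans_le
    (ge_of_tendsto (tendsto_eval_curve_div hβ ((expR_mem_face_iff hβ).2 hmin) x) ?_)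
  filter_upwards [(tendsto_norm_curve_atTop hj (hx j)).eventually_gt_atTop R] with t ht
  rw [le_div_iff₀ (Real.exp_pos _)]
  refine le_trans (le_of_eq_of_le ?_ (mul_le_mul_of_nonneg_left
    ((abs_monomial_le_supportSum (expR_mem_Newton hβ) _).trans (supportSum_le_P f _)) hc.le))
    (h _ ht)
  rw [prod_mul_exp_pow, abs_mul, Real.abs_exp, mul_assoc]
  simp only [mul_assoc, ← Finset.mul_sum]

theorem eval_trunc_pos_of_nondeg {n : ℕ} {f : MvPolynomial (Fin n) ℝ} (hf : f ≠ 0) {R : ℝ}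
    (hnd : Nondeg f) (h : ∀ x : Fin n → ℝ, R < ‖x‖ → 0 ≤ eval x f) {Δ : Set (Fin n → ℝ)}
    (hΔ : Δ ∈ NewtonBoundary f) {x : Fin n → ℝ} (hx : ∀ i, x i ≠ 0) :
    0 < eval x (trunc f Δ) := by
  refine (eval_trunc_nonneg hf h hΔ hx).lt_of_ne' fun h0 => hnd Δ hΔ ⟨x, hx, h0, fun i => ?_⟩
  refine eval_pderiv_eq_zero_of_isLocalMin ?_ i
  have hev : ∀ᶠ y in nhds x, ∀ i, y i ≠ 0 :=
    eventually_all.2 fun i => (continuous_apply i).continuousAt.eventually_ne (hx i)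
  filter_upwards [hev] with y hy
  rw [h0]
  exact eval_trunc_nonneg hf h hΔ hy

theorem LinearMap.exists_comp_comp_eq_self {K V W : Type*} [Field K] [AddCommGroup V] [Module K V]
    [AddCommGroup W] [Module K W] (L : V →ₗ[K] W) : ∃ G : W →ₗ[K] V, ∀ v, L (G (L v)) = L v := by
  obtain ⟨g, hg⟩ := L.rangeRestrict.exists_rightInverse_of_surjective L.range_rangeRestrict
  obtain ⟨e, he⟩ := (LinearMap.range L).subtype.exists_leftInverse_of_injective
    (LinearMap.range L).ker_subtype
  refine ⟨g ∘ₗ e, fun v => ?_⟩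
  have h1 : e (L v) = L.rangeRestrict v := LinearMap.congr_fun he (L.rangeRestrict v)
  have h2 := LinearMap.congr_fun hg (L.rangeRestrict v)
  rw [LinearMap.comp_apply, h1]
  exact congrArg Subtype.val h2

theorem Ultrafilter.exists_tendsto_of_bounded {ι : Type*} (U : Ultrafilter ι) {g : ι → ℝ} {a b : ℝ}
    (ha : ∀ᶠ k in U, a ≤ g k) (hb : ∀ᶠ k in U, g k ≤ b) : ∃ l, Tendsto g U (nhds l) := by
  obtain ⟨l, -, hl⟩ := isCompact_Icc.ultrafilter_le_nhds (U.map g)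
    (Filter.le_principal_iff.2 (ha.and hb) : (U.map g : Filter ℝ) ≤ Filter.principal (Set.Icc a b))
  exact ⟨l, hl⟩

/-- Along an ultrafilter escaping to infinity, the exponents of `f` of maximal growth are those of
a face at infinity, and their differences converge to those at a single point. -/
theorem exists_face_of_ultrafilter {n : ℕ} {ι : Type*} {f : MvPolynomial (Fin n) ℝ} (hf : f ≠ 0)
    (U : Ultrafilter ι) {y : ι → Fin n → ℝ} {j : Fin n}
    (hj : Tendsto (fun k => y k j) U atTop) :
    ∃ Δ ∈ NewtonBoundary f, ∃ α₀ : Fin n →₀ ℕ, ∃ z : Fin n → ℝ,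
      (∀ α ∈ f.support, ∀ᶠ k in U, (expR α - expR α₀) ⬝ᵥ y k ≤ 0) ∧
      (∀ α ∈ f.support, expR α ∈ Δ →
        Tendsto (fun k => (expR α - expR α₀) ⬝ᵥ y k) U (nhds ((expR α - expR α₀) ⬝ᵥ z))) ∧
      ∀ α ∈ f.support, expR α ∉ Δ →
        Tendsto (fun k => (expR α - expR α₀) ⬝ᵥ y k) U atBot := by
  obtain ⟨α₀, hα₀, hmax⟩ : ∃ α₀ ∈ (f.support : Set (Fin n →₀ ℕ)), ∀ᶠ k in U,
      ∀ α ∈ f.support, expR α ⬝ᵥ y k ≤ expR α₀ ⬝ᵥ y k :=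
    (Ultrafilter.eventually_exists_mem_iff f.support.finite_toSet).1 <| Eventually.of_forall
      fun k => Finset.exists_max_image f.support _ (support_nonempty.2 hf)
  have hle : ∀ α ∈ f.support, ∀ᶠ k in U, (expR α - expR α₀) ⬝ᵥ y k ≤ 0 := by
    intro α hα
    filter_upwards [hmax] with k hk
    rw [sub_dotProduct]
    exact sub_nonpos.2 (hk α hα)
  let T : Set (Fin n →₀ ℕ) :=
    {α | α ∈ f.support ∧ ∃ C, ∀ᶠ k in U, C ≤ (expR α - expR α₀) ⬝ᵥ y k}
  have hTfin : Finite T := f.support.finite_toSet.subset (fun α hα => hα.1)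
  let L := Matrix.mulVecLin (Matrix.of fun β : T => expR (β : Fin n →₀ ℕ) - expR α₀)
  have hL : ∀ v (β : T), L v β = (expR (β : Fin n →₀ ℕ) - expR α₀) ⬝ᵥ v := fun v β => rfl
  obtain ⟨G, hG⟩ := LinearMap.exists_comp_comp_eq_self L
  have hlim : ∀ β : T, ∃ l, Tendsto (fun k => L (y k) β) U (nhds l) := by
    rintro ⟨β, hβ, C, hC⟩
    exact U.exists_tendsto_of_bounded hC (hle β hβ)
  choose l hl using hlim
  have hz : Tendsto (fun k => G (L (y k))) U (nhds (G l)) :=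
    ((LinearMap.continuous_of_finiteDimensional G).tendsto l).comp (tendsto_pi_nhds.2 hl)
  have hzdot : ∀ v : Fin n → ℝ, Tendsto (fun k => v ⬝ᵥ G (L (y k))) U (nhds (v ⬝ᵥ G l)) :=
    fun v => ((by fun_prop : Continuous fun w : Fin n → ℝ => v ⬝ᵥ w).tendsto _).comp hz
  have hbot : ∀ α ∈ f.support, α ∉ T →
      Tendsto (fun k => (expR α - expR α₀) ⬝ᵥ y k) U atBot := by
    intro α hα hαT
    refine tendsto_atBot.2 fun C => ?_
    have hC : ¬ ∀ᶠ k in U, C ≤ (expR α - expR α₀) ⬝ᵥ y k := fun h => hαT ⟨hα, C, h⟩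
    filter_upwards [Ultrafilter.eventually_not.2 hC] with k hk
    exact (not_le.1 hk).le
  have hlt : ∀ᶠ k in U, ∀ α ∈ f.support, α ∉ T →
      (expR α - expR α₀) ⬝ᵥ (y k - G (L (y k))) < 0 := by
    refine (Filter.eventually_all_finset _).2 fun α hα => ?_
    by_cases hαT : α ∈ T
    · exact Eventually.of_forall fun _ h => absurd hαT h
    · filter_upwards [((hbot α hα hαT).atBot_add (hzdot _).neg).eventually_lt_atBot 0] with k hk _
      rwa [dotProduct_sub, sub_eq_add_neg]
  have hjpos : ∀ᶠ k in U, 0 < y k j - G (L (y k)) j := by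
    simpa only [sub_eq_add_neg] using
      (hj.atTop_add ((tendsto_pi_nhds.1 hz j).neg)).eventually_gt_atTop 0
  obtain ⟨k, hkT, hkj⟩ := (hlt.and hjpos).exists
  set p := y k - G (L (y k)) with hp
  have hpT : ∀ α ∈ T, (expR α - expR α₀) ⬝ᵥ p = 0 := by
    intro α hα
    have := congrFun (hG (y k)) ⟨α, hα⟩
    rw [hL, hL] at this
    rw [hp, dotProduct_sub, this, sub_self]
  have hface : ∀ α ∈ f.support, expR α ∈ face (-p) f ↔ α ∈ T := by
    intro α hα
    have hneg : ∀ v : Fin n → ℝ, ∑ i, (-p) i * v i = -(v ⬝ᵥ p) := fun v => by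
      rw [dotProduct_comm, ← neg_dotProduct]
      rfl
    have hple : ∀ γ ∈ f.support, (expR γ - expR α₀) ⬝ᵥ p ≤ 0 := fun γ hγ =>
      (em (γ ∈ T)).elim (fun h => (hpT γ h).le) fun h => (hkT γ hγ h).le
    rw [expR_mem_face_iff hα]
    simp only [hneg, neg_le_neg_iff]
    constructor
    · intro h
      by_contra hαT
      have := hkT α hα hαT
      rw [sub_dotProduct] at this
      linarith [h α₀ hα₀]
    · intro h γ hγ
      have h1 := hpT α h
      have h2 := hple γ hγ
      rw [sub_dotProduct] at h1 h2
      linarith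
  refine ⟨face (-p) f, ⟨-p, ⟨j, neg_neg_of_pos hkj⟩, rfl⟩, α₀, G l, hle, fun α hα hαΔ => ?_,
    fun α hα hαΔ => hbot α hα fun h => hαΔ ((hface α hα).2 h)⟩
  refine (hzdot (expR α - expR α₀)).congr fun k => ?_
  exact congrFun (hG (y k)) ⟨α, (hface α hα).1 hαΔ⟩

theorem Ultrafilter.exists_eventually_eq_mul_exp_log {ι : Type*} (U : Ultrafilter ι) {g : ι → ℝ}
    (hg : ∀ k, g k ≠ 0) :
    ∃ s : ℝ, |s| = 1 ∧ ∀ᶠ k in U, g k = s * Real.exp (Real.log |g k|) := by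
  have h : ∀ᶠ k in U, g k < 0 ∨ 0 < g k := Eventually.of_forall fun k => (hg k).lt_or_gt
  rcases Ultrafilter.eventually_or.1 h with h | h
  · refine ⟨-1, by simp, h.mono fun k hk => ?_⟩
    rw [Real.exp_log (abs_pos.2 (hg k)), abs_of_neg hk]
    ring
  · refine ⟨1, by simp, h.mono fun k hk => ?_⟩
    rw [Real.exp_log (abs_pos.2 (hg k)), abs_of_pos hk, one_mul]

theorem Ultrafilter.exists_tendsto_log_abs_atTop {n : ℕ} {ι : Type*} (U : Ultrafilter ι)
    {x : ι → Fin n → ℝ} (hx : Tendsto (fun k => ‖x k‖) U atTop) :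
    ∃ j, Tendsto (fun k => Real.log |x k j|) U atTop := by
  have h : ∀ᶠ k in U, ∃ j, ‖x k‖ ≤ |x k j| := by
    filter_upwards [hx.eventually_gt_atTop 0] with k hk
    by_contra! hlt
    exact lt_irrefl _ ((pi_norm_lt_iff hk).2 hlt)
  obtain ⟨j, hj⟩ := Ultrafilter.eventually_exists_iff.1 h
  exact ⟨j, Real.tendsto_log_atTop.comp (tendsto_atTop_mono' _ hj hx)⟩

theorem not_tendsto_of_eval_lt {n : ℕ} {ι : Type*} {f : MvPolynomial (Fin n) ℝ} (hf : f ≠ 0)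
    (hpos : ∀ Δ ∈ NewtonBoundary f, ∀ x : Fin n → ℝ, (∀ i, x i ≠ 0) → 0 < eval x (trunc f Δ))
    (U : Ultrafilter ι) {x : ι → Fin n → ℝ} (hx0 : ∀ k i, x k i ≠ 0)
    (hx : Tendsto (fun k => ‖x k‖) U atTop) {ε : ι → ℝ} (hε : ∀ k, 0 ≤ ε k)
    (hlt : ∀ k, eval (x k) f ≤ ε k * supportSum f (x k)) : ¬ Tendsto ε U (nhds 0) := by
  intro hε0
  obtain ⟨j, hj⟩ := U.exists_tendsto_log_abs_atTop hx
  choose s hs hxs using fun i => U.exists_eventually_eq_mul_exp_log (fun k => hx0 k i)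
  obtain ⟨Δ, hΔ, α₀, z, hle, hmem, hnot⟩ := exists_face_of_ultrafilter hf U
    (y := fun k i => Real.log |x k i|) hj
  set y : ι → Fin n → ℝ := fun k i => Real.log |x k i|
  have hs0 : ∀ i, s i ≠ 0 := fun i => abs_ne_zero.1 (by rw [hs i]; exact one_ne_zero)
  have hxs' : ∀ᶠ k in U, ∀ i, x k i = s i * Real.exp (y k i) := eventually_all.2 hxs
  have hterm : ∀ α : Fin n →₀ ℕ, (fun k => (∏ i, s i ^ α i) *
      Real.exp ((expR α - expR α₀) ⬝ᵥ y k)) =ᶠ[U]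
      fun k => (∏ i, x k i ^ α i) / Real.exp (expR α₀ ⬝ᵥ y k) := by
    intro α
    filter_upwards [hxs'] with k hk
    simp only [hk, prod_mul_exp_pow]
    rw [mul_div_assoc, ← Real.exp_sub, sub_dotProduct, dotProduct_comm]
    rfl
  have hlim : Tendsto (fun k => eval (x k) f / Real.exp (expR α₀ ⬝ᵥ y k)) U
      (nhds (eval (fun i => s i * Real.exp (z i)) (trunc f Δ) * Real.exp (-(expR α₀ ⬝ᵥ z)))) := by
    refine tendsto_eval_div f Δ (fun α hα h => ?_) (fun α hα h => ?_)
    · rw [prod_mul_exp_pow, mul_assoc, ← Real.exp_add, ← sub_eq_add_neg]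
      have hz : ∑ i, z i * expR α i - expR α₀ ⬝ᵥ z = (expR α - expR α₀) ⬝ᵥ z := by
        rw [sub_dotProduct, dotProduct_comm (expR α)]
        rfl
      rw [hz]
      exact (((Real.continuous_exp.tendsto _).comp (hmem α hα h)).const_mul _).congr' (hterm α)
    · rw [← mul_zero (∏ i, s i ^ α i)]
      exact ((Real.tendsto_exp_atBot.comp (hnot α hα h)).const_mul _).congr' (hterm α)
  have hupper : ∀ᶠ k in U, eval (x k) f / Real.exp (expR α₀ ⬝ᵥ y k) ≤
      ε k * f.support.card := by
    have hle' : ∀ᶠ k in U, ∀ α ∈ f.support, (expR α - expR α₀) ⬝ᵥ y k ≤ 0 :=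
      (Filter.eventually_all_finset _).2 hle
    filter_upwards [hxs', hle'] with k hk hk'
    rw [div_le_iff₀ (Real.exp_pos _), mul_assoc]
    refine (hlt k).trans (mul_le_mul_of_nonneg_left ?_ (hε k))
    rw [← nsmul_eq_mul]
    refine Finset.sum_le_card_nsmul _ _ _ fun α hα => ?_
    have h := hk' α hα
    rw [sub_dotProduct, sub_nonpos, dotProduct_comm] at h
    simp only [hk, prod_mul_exp_pow]
    rw [abs_mul, Real.abs_exp, Finset.abs_prod]
    simpa [abs_pow, hs, dotProduct] using h
  have h0 := le_of_tendsto_of_tendsto hlim (hε0.mul_const _) hupper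
  rw [zero_mul] at h0
  exact h0.not_gt (mul_pos (hpos Δ hΔ _ fun i => mul_ne_zero (hs0 i) (Real.exp_ne_zero _))
    (Real.exp_pos _))

theorem exists_supportSum_le_eval_of_ne_zero {n : ℕ} {f : MvPolynomial (Fin n) ℝ} (hf : f ≠ 0)
    (hpos : ∀ Δ ∈ NewtonBoundary f, ∀ x : Fin n → ℝ, (∀ i, x i ≠ 0) → 0 < eval x (trunc f Δ)) :
    ∃ c > (0 : ℝ), ∃ R > (0 : ℝ), ∀ x : Fin n → ℝ, R < ‖x‖ → (∀ i, x i ≠ 0) →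
      c * supportSum f x ≤ eval x f := by
  by_contra! h
  choose x hxR hx0 hlt using
    fun k : ℕ => h (1 / ((k : ℝ) + 1)) (by positivity) (k + 1) (by positivity)
  have hU := Nat.hyperfilter_le_atTop
  refine not_tendsto_of_eval_lt hf hpos (hyperfilter ℕ) hx0 ?_ (fun k => by positivity)
    (fun k => (hlt k).le) (tendsto_one_div_add_atTop_nhds_zero_nat.mono_left hU)
  refine tendsto_atTop_mono (fun k => ?_) (tendsto_natCast_atTop_atTop.mono_left hU)
  linarith [hxR k]

theorem exists_supportSum_le_eval {n : ℕ} {f : MvPolynomial (Fin n) ℝ} (hf : f ≠ 0)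
    (hpos : ∀ Δ ∈ NewtonBoundary f, ∀ x : Fin n → ℝ, (∀ i, x i ≠ 0) → 0 < eval x (trunc f Δ)) :
    ∃ c > (0 : ℝ), ∃ R > (0 : ℝ), ∀ x : Fin n → ℝ, R < ‖x‖ → c * supportSum f x ≤ eval x f := by
  obtain ⟨c, hc, R, hR, h⟩ := exists_supportSum_le_eval_of_ne_zero hf hpos
  refine ⟨c, hc, R, hR, fun x hx => ?_⟩
  have hdense : Dense (Set.pi Set.univ fun _ : Fin n => ({0}ᶜ : Set ℝ)) :=
    dense_pi _ fun _ _ => dense_compl_singleton 0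
  have hopen : IsOpen {x : Fin n → ℝ | R < ‖x‖} := isOpen_lt continuous_const continuous_norm
  have hclosed : IsClosed {x : Fin n → ℝ | c * supportSum f x ≤ eval x f} := by
    refine isClosed_le ?_ (MvPolynomial.continuous_eval f)
    unfold supportSum
    fun_prop
  refine closure_minimal ?_ hclosed (hdense.open_subset_closure_inter hopen hx)
  rintro v ⟨hv, hv0⟩
  exact h v hv fun i => hv0 i trivial

theorem stmt11 {n : ℕ} (hn : 2 ≤ n) (f : MvPolynomial (Fin n) ℝ) (hf : f.totalDegree ≠ 0) :
    ((∀ Δ ∈ NewtonBoundary f, ∀ x : Fin n → ℝ, (∀ i, x i ≠ 0) → 0 < eval x (trunc f Δ)) ↔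
      (∃ c₁ > (0 : ℝ), ∃ c₂ > (0 : ℝ), ∃ R > (0 : ℝ), ∀ x : Fin n → ℝ, R < ‖x‖ →
        c₁ * P f x ≤ eval x f ∧ eval x f ≤ c₂ * P f x)) ∧
    ((∃ c₁ > (0 : ℝ), ∃ c₂ > (0 : ℝ), ∃ R > (0 : ℝ), ∀ x : Fin n → ℝ, R < ‖x‖ →
        c₁ * P f x ≤ eval x f ∧ eval x f ≤ c₂ * P f x) ↔
      (Nondeg f ∧ ∃ R > (0 : ℝ), ∀ x : Fin n → ℝ, R < ‖x‖ → 0 ≤ eval x f)) := by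
  have hf0 : f ≠ 0 := fun h => hf (by rw [h, totalDegree_zero])
  have hab : (∀ Δ ∈ NewtonBoundary f, ∀ x : Fin n → ℝ, (∀ i, x i ≠ 0) →
      0 < eval x (trunc f Δ)) → ∃ c₁ > (0 : ℝ), ∃ c₂ > (0 : ℝ), ∃ R > (0 : ℝ), ∀ x : Fin n → ℝ,
        R < ‖x‖ → c₁ * P f x ≤ eval x f ∧ eval x f ≤ c₂ * P f x := by
    intro hpos
    obtain ⟨c, hc, R, hR, h⟩ := exists_supportSum_le_eval hf0 hpos
    obtain ⟨N, hN, hP⟩ := P_le_supportSum f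
    obtain ⟨c₂, hc₂, hle⟩ := eval_le_P f
    refine ⟨c / N, div_pos hc hN, c₂, hc₂, R, hR, fun x hx => ⟨le_trans ?_ (h x hx), hle x⟩⟩
    calc c / N * P f x ≤ c / N * (N * supportSum f x) := by gcongr; exact hP x
      _ = c * supportSum f x := by field_simp
  have hba : (∃ c₁ > (0 : ℝ), ∃ c₂ > (0 : ℝ), ∃ R > (0 : ℝ), ∀ x : Fin n → ℝ,
      R < ‖x‖ → c₁ * P f x ≤ eval x f ∧ eval x f ≤ c₂ * P f x) →
      ∀ Δ ∈ NewtonBoundary f, ∀ x : Fin n → ℝ, (∀ i, x i ≠ 0) → 0 < eval x (trunc f Δ) := by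
    rintro ⟨c₁, hc₁, c₂, -, R, -, h⟩ Δ hΔ x hx
    exact eval_trunc_pos_of_P_le hf0 hc₁ (fun x hx => (h x hx).1) hΔ hx
  refine ⟨⟨hab, hba⟩, fun hb => ⟨?_, ?_⟩, ?_⟩
  · rintro Δ hΔ ⟨x, hx, h0, -⟩
    exact (hba hb Δ hΔ x hx).ne' h0
  · obtain ⟨c₁, hc₁, c₂, -, R, hR, h⟩ := hb
    exact ⟨R, hR, fun x hx => (mul_nonneg hc₁.le (P_nonneg f x)).trans (h x hx).1⟩
  · rintro ⟨hnd, R, -, h⟩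
    exact hab fun Δ hΔ x hx => eval_trunc_pos_of_nondeg hf0 hnd h hΔ hx
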